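/- Let I be a monomial ideal in k[ℕA], let 𝒮 be the set of faces F of A such that I has a standard pair belonging to F, and for F ∈ 𝒮 let C_F be the p_F-primary monomial ideal whose standard monomials are the elements of ℕA dividing some element of a + ℕF for a standard pair (a,F) of I belonging to F with overlap class maximal with respect to divisibility. Then I = ⋂_{F ∈ 𝒮} C_F, and this primary decomposition is irredundant: the primes p_F (F ∈ 𝒮) are pairwise distinct and for every G ∈ 𝒮 the intersection ⋂_{F ∈ 𝒮, F ≠ G} C_F is not contained in C_G. -/

import Mathlib

open scoped BigOperators

namespace StdPairsPaper

/-- The coercion of a lattice point to a real vector. -/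
def toR {d : ℕ} (v : Fin d → ℤ) : Fin d → ℝ := fun i => (v i : ℝ)

/-- The cone of nonnegative real combinations of (the real images of) elements of `S`. -/
def cone {d : ℕ} (S : Set (Fin d → ℤ)) : Set (Fin d → ℝ) :=
  {x | ∃ (t : Finset (Fin d → ℤ)) (c : (Fin d → ℤ) → ℝ),
    (t : Set (Fin d → ℤ)) ⊆ S ∧ (∀ v, 0 ≤ c v) ∧ x = ∑ v ∈ t, c v • toR v}

/-- `ℕS`, the submonoid of `ℤ^d` generated by `S`. -/
def NSemi {d : ℕ} (S : Set (Fin d → ℤ)) : AddSubmonoid (Fin d → ℤ) :=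
  AddSubmonoid.closure S

/-- `ℤS`, the subgroup of `ℤ^d` generated by `S`. -/
def ZGrp {d : ℕ} (S : Set (Fin d → ℤ)) : AddSubgroup (Fin d → ℤ) :=
  AddSubgroup.closure S

/-- `ℝS`, the real linear span of `S`. -/
def RSpan {d : ℕ} (S : Set (Fin d → ℤ)) : Submodule ℝ (Fin d → ℝ) :=
  Submodule.span ℝ (toR '' S)

/-- `A` is a configuration: a finite set of nonzero lattice points whose `ℤ`-span is `ℤ^d`
and whose nonnegative real cone is strongly convex (contains no line, i.e. is pointed). -/
structure IsConfig {d : ℕ} (A : Set (Fin d → ℤ)) : Prop where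
  (finite : A.Finite)
  (nonzero : (0 : Fin d → ℤ) ∉ A)
  (spans : ZGrp A = ⊤)
  (pointed : ∀ x ∈ cone A, -x ∈ cone A → x = 0)

/-- `F` is a face of the configuration `A`: `F ⊆ A`, the cone over `F` is an extreme
subset (face) of the cone over `A`, and `ℝ_{≥0}F ∩ A = F`. -/
def IsFace {d : ℕ} (A F : Set (Fin d → ℤ)) : Prop :=
  F ⊆ A ∧ IsExtreme ℝ (cone A) (cone F) ∧ cone F ∩ (toR '' A) = toR '' F

/-- The set `a + ℕF`. -/
def cell {d : ℕ} (a : Fin d → ℤ) (F : Set (Fin d → ℤ)) : Set (Fin d → ℤ) :=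
  {x | ∃ f ∈ NSemi F, x = a + f}

/-- Two pairs `(a,F)` and `(b,F)` belonging to the same face `F` overlap: `a - b ∈ ℤF`. -/
def Overlap {d : ℕ} (F : Set (Fin d → ℤ)) (a b : Fin d → ℤ) : Prop :=
  a - b ∈ ZGrp F

/-- The pair `(a,F)` divides the pair `(b,G)`:
there is `c ∈ ℕA` with `a + c + ℕF ⊆ b + ℕG`. -/
def PairDvd {d : ℕ} (A : Set (Fin d → ℤ)) (a : Fin d → ℤ) (F : Set (Fin d → ℤ))
    (b : Fin d → ℤ) (G : Set (Fin d → ℤ)) : Prop :=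
  ∃ c ∈ NSemi A, cell (a + c) F ⊆ cell b G

/-- `E` is the exponent set of a monomial ideal of `ℕA`: `E ⊆ ℕA` and `E + ℕA ⊆ E`. -/
def IsExpSet {d : ℕ} (A E : Set (Fin d → ℤ)) : Prop :=
  E ⊆ (NSemi A : Set (Fin d → ℤ)) ∧ ∀ e ∈ E, ∀ c ∈ NSemi A, e + c ∈ E

/-- The standard monomials of `E`: `ℕA ∖ E`. -/
def stdSet {d : ℕ} (A E : Set (Fin d → ℤ)) : Set (Fin d → ℤ) :=
  (NSemi A : Set (Fin d → ℤ)) \ E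

/-- `(a,F)` is a proper pair of `E`: a pair of `A` with `a + ℕF ⊆ std(E)`. -/
def ProperPair {d : ℕ} (A E : Set (Fin d → ℤ)) (a : Fin d → ℤ)
    (F : Set (Fin d → ℤ)) : Prop :=
  a ∈ NSemi A ∧ IsFace A F ∧ cell a F ⊆ stdSet A E

/-- `(a,F)` is a standard pair of `E`: a proper pair of `E` maximal with respect to
the partial order `(a,F) ≼ (b,G) ↔ a + ℕF ⊆ b + ℕG`. -/
def StdPair {d : ℕ} (A E : Set (Fin d → ℤ)) (a : Fin d → ℤ)
    (F : Set (Fin d → ℤ)) : Prop :=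
  ProperPair A E a F ∧
    ∀ b G, ProperPair A E b G → cell a F ⊆ cell b G → cell b G ⊆ cell a F

/-- The overlap class of the standard pair `(a,F)` of `E` is maximal with respect to
divisibility among overlap classes of standard pairs of `E`. -/
def MaxClass {d : ℕ} (A E : Set (Fin d → ℤ)) (a : Fin d → ℤ)
    (F : Set (Fin d → ℤ)) : Prop :=
  ∀ b G, StdPair A E b G → PairDvd A a F b G → PairDvd A b G a F

noncomputable section

/-- The affine semigroup ring `k[ℕA]`. -/
abbrev SGRing {d : ℕ} (k : Type*) [Field k] (A : Set (Fin d → ℤ)) :=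
  AddMonoidAlgebra k (NSemi A)

/-- The monomial `t^a` of `k[ℕA]`. -/
def mono {d : ℕ} (k : Type*) [Field k] (A : Set (Fin d → ℤ)) (a : (NSemi A)) :
    SGRing k A :=
  AddMonoidAlgebra.single a 1

/-- `I` is a monomial ideal of `k[ℕA]`: an ideal generated by monomials. -/
def IsMonomialIdeal {d : ℕ} (k : Type*) [Field k] (A : Set (Fin d → ℤ))
    (I : Ideal (SGRing k A)) : Prop :=
  ∃ S : Set (NSemi A), I = Ideal.span ((fun a => mono k A a) '' S)

/-- The exponent set `E(I) = {a ∈ ℕA : t^a ∈ I}` of an ideal of `k[ℕA]`,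
as a subset of `ℤ^d`. -/
def expSet {d : ℕ} (k : Type*) [Field k] (A : Set (Fin d → ℤ))
    (I : Ideal (SGRing k A)) : Set (Fin d → ℤ) :=
  {x | ∃ h : x ∈ NSemi A, mono k A ⟨x, h⟩ ∈ I}

/-- The monomial prime ideal `p_F = ⟨t^a : a ∈ ℕA ∖ ℕF⟩` of `k[ℕA]`. -/
def primeF {d : ℕ} (k : Type*) [Field k] (A F : Set (Fin d → ℤ)) :
    Ideal (SGRing k A) :=
  Ideal.span {x | ∃ a : (NSemi A), (a : Fin d → ℤ) ∉ NSemi F ∧ x = mono k A a}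

end


section Cone

variable {d : ℕ}

theorem toR_zero : toR (0 : Fin d → ℤ) = 0 := by
  ext; simp [toR]

theorem toR_add (u v : Fin d → ℤ) : toR (u + v) = toR u + toR v := by
  ext; simp [toR]

theorem toR_sub (u v : Fin d → ℤ) : toR (u - v) = toR u - toR v := by
  ext; simp [toR]

theorem toR_nsmul (n : ℕ) (v : Fin d → ℤ) : toR (n • v) = (n : ℝ) • toR v := by
  ext; simp [toR]

theorem toR_injective : Function.Injective (toR (d := d)) := by
  intro u v h
  ext i
  have hi : (u i : ℝ) = v i := congrFun h i
  exact_mod_cast hi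

variable {S T : Set (Fin d → ℤ)}

theorem zero_mem_cone : (0 : Fin d → ℝ) ∈ cone S :=
  ⟨∅, 0, by simp, by simp, by simp⟩

theorem add_mem_cone {x y : Fin d → ℝ} (hx : x ∈ cone S) (hy : y ∈ cone S) :
    x + y ∈ cone S := by
  classical
  obtain ⟨s, b, hs, hb, rfl⟩ := hx
  obtain ⟨t, c, ht, hc, rfl⟩ := hy
  refine ⟨s ∪ t, fun v => (if v ∈ s then b v else 0) + (if v ∈ t then c v else 0), ?_, ?_, ?_⟩
  · simp [hs, ht]
  · intro v
    have := hb v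
    have := hc v
    dsimp only
    split_ifs <;> positivity
  · simp only [add_smul, Finset.sum_add_distrib, ite_smul, zero_smul]
    congr 1 <;> rw [← Finset.sum_filter] <;> congr 1 <;> ext v <;> simp +contextual

theorem smul_mem_cone {x : Fin d → ℝ} {r : ℝ} (hr : 0 ≤ r) (hx : x ∈ cone S) :
    r • x ∈ cone S := by
  obtain ⟨s, b, hs, hb, rfl⟩ := hx
  exact ⟨s, fun v => r * b v, hs, fun v => mul_nonneg hr (hb v), by
    simp [Finset.smul_sum, mul_smul]⟩

theorem toR_mem_cone {v : Fin d → ℤ} (hv : v ∈ S) : toR v ∈ cone S :=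
  ⟨{v}, fun _ => 1, by simpa, by simp, by simp⟩

theorem sum_mem_cone {ι : Type*} (s : Finset ι) (f : ι → Fin d → ℝ)
    (hf : ∀ i ∈ s, f i ∈ cone S) : ∑ i ∈ s, f i ∈ cone S :=
  Finset.sum_induction f (· ∈ cone S) (fun _ _ => add_mem_cone) zero_mem_cone hf

theorem cone_mono (h : S ⊆ T) : cone S ⊆ cone T := by
  rintro x ⟨s, b, hs, hb, hx⟩
  exact ⟨s, b, hs.trans h, hb, hx⟩

theorem toR_mem_cone_of_mem_NSemi {x : Fin d → ℤ} (hx : x ∈ NSemi S) : toR x ∈ cone S := by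
  induction hx using AddSubmonoid.closure_induction with
  | mem x hx => exact toR_mem_cone hx
  | zero => rw [toR_zero]; exact zero_mem_cone
  | add x y _ _ hx hy => rw [toR_add]; exact add_mem_cone hx hy

/-- Every element of a cone is a nonnegative combination of those generators of which it admits
a positive multiple as a summand. -/
theorem mem_cone_of_summands {x : Fin d → ℝ} (hx : x ∈ cone S)
    (h : ∀ v ∈ S, ∀ r : ℝ, 0 < r → x - r • toR v ∈ cone S → v ∈ T) : x ∈ cone T := by
  classical
  obtain ⟨s, b, hs, hb, rfl⟩ := hx
  refine sum_mem_cone _ _ fun v hv => ?_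
  rcases (hb v).eq_or_lt with h0 | h0
  · rw [← h0, zero_smul]
    exact zero_mem_cone
  · refine smul_mem_cone h0.le (toR_mem_cone (h v (hs hv) _ h0 ?_))
    rw [← Finset.add_sum_erase _ _ hv, add_sub_cancel_left]
    exact sum_mem_cone _ _ fun w hw =>
      smul_mem_cone (hb w) (toR_mem_cone (hs (Finset.mem_of_mem_erase hw)))

/-- Finitely many positive reals can be mapped to positive rationals by a `ℚ`-linear map. -/
theorem exists_rat_linearMap_pos (s : Finset ℝ) (hs : ∀ x ∈ s, 0 < x) :
    ∃ φ : ℝ →ₗ[ℚ] ℚ, ∀ x ∈ s, 0 < φ x := by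
  classical
  let V := Submodule.span ℚ (s : Set ℝ)
  let b := Module.finBasis ℚ V
  have hsV : ∀ x ∈ s, x ∈ V := fun x hx => Submodule.subset_span hx
  let U : Set (Fin (Module.finrank ℚ V) → ℝ) :=
    ⋂ x : s, {q | 0 < ∑ i, (b.repr ⟨x, hsV x x.2⟩ i : ℝ) * q i}
  have hU : IsOpen U := isOpen_iInter_of_finite fun x =>
    isOpen_lt continuous_const (by fun_prop)
  have hne : U.Nonempty := by
    refine ⟨fun i => (b i : ℝ), Set.mem_iInter.2 fun x => ?_⟩
    have h := congrArg (Subtype.val) (b.sum_repr ⟨x, hsV x x.2⟩)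
    simp only [Submodule.coe_sum, Submodule.coe_smul, Rat.smul_def] at h
    simpa only [Set.mem_ofPred_eq, h] using hs x x.2
  obtain ⟨q, hq⟩ := (DenseRange.piMap
    fun _ : Fin (Module.finrank ℚ V) => Rat.denseRange_cast (𝕜 := ℝ)).exists_mem_open hU hne
  obtain ⟨φ, hφ⟩ := (b.constr ℚ q).exists_extend
  refine ⟨φ, fun x hx => ?_⟩
  have h1 : φ x = b.constr ℚ q ⟨x, hsV x hx⟩ := by rw [← hφ]; rfl
  have h2 := Set.mem_iInter.1 hq ⟨x, hx⟩
  rw [h1, b.constr_apply_fintype ℚ]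
  simp only [Set.mem_ofPred_eq, Pi.map_apply] at h2
  simp only [Module.Basis.equivFun_apply, smul_eq_mul]
  exact_mod_cast h2

/-- A lattice point of the real cone has a positive multiple in the monoid. -/
theorem exists_nsmul_mem_NSemi {u : Fin d → ℤ} (hu : toR u ∈ cone S) :
    ∃ n : ℕ, 0 < n ∧ n • u ∈ NSemi S := by
  classical
  obtain ⟨s, c, hs, hc, hx⟩ := hu
  obtain ⟨φ, hφ⟩ := exists_rat_linearMap_pos (insert 1 ((s.image c).filter (0 < ·))) (by
    intro x hx
    rcases Finset.mem_insert.1 hx with rfl | hx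
    · exact one_pos
    · exact (Finset.mem_filter.1 hx).2)
  have h1 : 0 < φ 1 := hφ 1 (Finset.mem_insert_self _ _)
  have h0 : ∀ v ∈ s, 0 ≤ φ (c v) := by
    intro v hv
    rcases (hc v).eq_or_lt with h | h
    · rw [← h, map_zero]
    · exact (hφ _ (Finset.mem_insert_of_mem
        (Finset.mem_filter.2 ⟨Finset.mem_image_of_mem _ hv, h⟩))).le
  have hcoord : ∀ i, φ 1 * u i = ∑ v ∈ s, φ (c v) * v i := by
    intro i
    have h := congrArg φ (congrFun hx i)
    have hmul : ∀ (x : ℝ) (z : ℤ), φ (x * z) = φ x * z := by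
      intro x z
      rw [mul_comm, ← zsmul_eq_mul, map_zsmul, zsmul_eq_mul, mul_comm]
    simp only [toR, Finset.sum_apply, Pi.smul_apply, smul_eq_mul, map_sum, hmul] at h
    rw [← h, ← hmul, one_mul]
  obtain ⟨D, hD⟩ := IsLocalization.exist_integer_multiples_of_finset (nonZeroDivisors ℤ)
    (insert (φ 1) (s.image fun v => φ (c v)))
  have hD0 : (D : ℤ) ≠ 0 := nonZeroDivisors.ne_zero D.2
  have key : ∀ q : ℚ, 0 ≤ q → IsLocalization.IsInteger ℤ ((D : ℤ) • q) →
      ∃ m : ℕ, (m : ℚ) = |(D : ℚ)| * q := by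
    rintro q hq ⟨z, hz⟩
    refine ⟨z.natAbs, ?_⟩
    rw [Nat.cast_natAbs, Int.cast_abs]
    have : (z : ℚ) = D * q := by simpa using hz
    rw [this, abs_mul, abs_of_nonneg hq]
  obtain ⟨n, hn⟩ := key _ h1.le (hD _ (Finset.mem_insert_self _ _))
  have hm : ∀ v : s, ∃ m : ℕ, (m : ℚ) = |(D : ℚ)| * φ (c v) := fun v =>
    key _ (h0 v v.2) (hD _ (Finset.mem_insert_of_mem
      (Finset.mem_image_of_mem (fun v => φ (c v)) v.2)))
  choose m hm using hm
  have hDpos : 0 < |(D : ℚ)| := abs_pos.2 (by exact_mod_cast hD0)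
  refine ⟨n, ?_, ?_⟩
  · have : (0 : ℚ) < n := hn ▸ mul_pos hDpos h1
    exact_mod_cast this
  · have : n • u = ∑ v : s, m v • (v : Fin d → ℤ) := by
      ext i
      have h : (n : ℚ) * u i = ∑ v : s, (m v : ℚ) * (v : Fin d → ℤ) i := by
        simp only [hn, hm, mul_assoc, hcoord i, Finset.mul_sum]
        exact (Finset.sum_coe_sort s fun v => |(D : ℚ)| * (φ (c v) * (v i : ℚ))).symm
      simp only [Pi.smul_apply, Finset.sum_apply, nsmul_eq_mul]
      exact_mod_cast h
    rw [this]
    exact sum_mem fun v _ => nsmul_mem (AddSubmonoid.subset_closure (hs v.2)) _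

end Cone

section Face

variable {d : ℕ} {A F G : Set (Fin d → ℤ)}

theorem NSemi_mono (h : F ⊆ G) : NSemi F ≤ NSemi G :=
  AddSubmonoid.closure_mono h

theorem sum_mem_NSemi {s : Finset (Fin d → ℤ)} {m : (Fin d → ℤ) → ℕ}
    (h : ∀ v ∈ s, m v ≠ 0 → v ∈ F) : ∑ v ∈ s, m v • v ∈ NSemi F := by
  refine sum_mem fun v hv => ?_
  rcases eq_or_ne (m v) 0 with h0 | h0
  · rw [h0, zero_smul]
    exact zero_mem _
  · exact nsmul_mem (AddSubmonoid.subset_closure (h v hv h0)) _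

theorem exists_sum_of_mem_NSemi {s : Finset (Fin d → ℤ)} (hF : F ⊆ s) {x : Fin d → ℤ}
    (hx : x ∈ NSemi F) : ∃ m : (Fin d → ℤ) → ℕ, (∀ v ∉ F, m v = 0) ∧ ∑ v ∈ s, m v • v = x := by
  classical
  induction hx using AddSubmonoid.closure_induction with
  | mem x hx =>
    refine ⟨Pi.single x 1, fun v hv => Pi.single_eq_of_ne (by rintro rfl; exact hv hx) _, ?_⟩
    rw [Finset.sum_eq_single_of_mem x (hF hx) fun v _ hv => by
      rw [Pi.single_eq_of_ne hv, zero_smul], Pi.single_eq_same, one_smul]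
  | zero => exact ⟨0, by simp, by simp⟩
  | add x y _ _ hx hy =>
    obtain ⟨m, hm, rfl⟩ := hx
    obtain ⟨n, hn, rfl⟩ := hy
    exact ⟨m + n, fun v hv => by simp [hm v hv, hn v hv], by
      simp [add_smul, Finset.sum_add_distrib]⟩

theorem IsFace.mem_of_toR_mem_cone (hF : IsFace A F) {v : Fin d → ℤ} (hv : v ∈ A)
    (h : toR v ∈ cone F) : v ∈ F := by
  have : toR v ∈ toR '' F := hF.2.2 ▸ ⟨h, v, hv, rfl⟩
  exact (toR_injective.mem_set_image).1 this

theorem IsFace.mem_of_mem_NSemi (hF : IsFace A F) {v : Fin d → ℤ} (hv : v ∈ A)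
    (h : v ∈ NSemi F) : v ∈ F :=
  hF.mem_of_toR_mem_cone hv (toR_mem_cone_of_mem_NSemi h)

theorem IsFace.mem_cone_of_add_mem (hF : IsFace A F) {x y : Fin d → ℝ} (hx : x ∈ cone A)
    (hy : y ∈ cone A) (h : x + y ∈ cone F) : x ∈ cone F := by
  have h2 : (2 : ℝ) • x ∈ cone F := by
    refine hF.2.1.left_mem_of_mem_openSegment (smul_mem_cone zero_le_two hx)
      (smul_mem_cone zero_le_two hy) h ⟨1 / 2, 1 / 2, by norm_num, by norm_num, by norm_num, ?_⟩
    simp [smul_smul]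
  simpa [smul_smul] using smul_mem_cone (r := 1 / 2) (by norm_num) h2

theorem IsFace.mem_NSemi_of_add_mem (hF : IsFace A F) {x y : Fin d → ℤ} (hx : x ∈ NSemi A)
    (hy : y ∈ NSemi A) (h : x + y ∈ NSemi F) : x ∈ NSemi F := by
  induction hx using AddSubmonoid.closure_induction generalizing y with
  | mem x hx =>
    refine AddSubmonoid.subset_closure (hF.mem_of_toR_mem_cone hx ?_)
    refine hF.mem_cone_of_add_mem (toR_mem_cone hx) (toR_mem_cone_of_mem_NSemi hy) ?_
    rw [← toR_add]
    exact toR_mem_cone_of_mem_NSemi h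
  | zero => exact zero_mem _
  | add x z hx hz ihx ihz =>
    exact add_mem (ihx (add_mem hz hy) (by rwa [← add_assoc]))
      (ihz (add_mem hx hy) (by rwa [add_left_comm, ← add_assoc]))

theorem IsFace.eq_of_NSemi_eq (hF : IsFace A F) (hG : IsFace A G) (h : NSemi F = NSemi G) :
    F = G :=
  Set.Subset.antisymm
    (fun _ hv => hG.mem_of_mem_NSemi (hF.1 hv) (h ▸ AddSubmonoid.subset_closure hv))
    (fun _ hv => hF.mem_of_mem_NSemi (hG.1 hv) (h ▸ AddSubmonoid.subset_closure hv))

theorem mem_cell_self {a : Fin d → ℤ} : a ∈ cell a F :=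
  ⟨0, zero_mem _, (add_zero a).symm⟩

theorem add_mem_cell {a f : Fin d → ℤ} (hf : f ∈ NSemi F) : a + f ∈ cell a F :=
  ⟨f, hf, rfl⟩

theorem cell_subset_cell (h : F ⊆ G) {a b : Fin d → ℤ} (hab : a ∈ cell b G) :
    cell a F ⊆ cell b G := by
  obtain ⟨g, hg, rfl⟩ := hab
  rintro _ ⟨f, hf, rfl⟩
  exact ⟨g + f, add_mem hg (NSemi_mono h hf), add_assoc _ _ _⟩

theorem IsFace.subset_of_cell_subset (hF : F ⊆ A) (hG : IsFace A G) {a b : Fin d → ℤ}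
    (h : cell a F ⊆ cell b G) : F ⊆ G := by
  intro f hf
  have hf' : f ∈ NSemi F := AddSubmonoid.subset_closure hf
  obtain ⟨g, hg, rfl⟩ := h mem_cell_self
  obtain ⟨g', hg', hgg'⟩ := h (add_mem_cell hf')
  refine hG.mem_of_mem_NSemi (hF hf)
    (hG.mem_NSemi_of_add_mem (NSemi_mono hF hf') (NSemi_mono hG.1 hg) ?_)
  have : f + g = g' := by
    apply add_left_cancel (a := b)
    rw [← hgg']
    abel
  rwa [this]

theorem cell_face_eq (hF : IsFace A F) (hG : IsFace A G) {a b : Fin d → ℤ}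
    (h : cell a F ⊆ cell b G) (h' : cell b G ⊆ cell a F) : F = G :=
  (hG.subset_of_cell_subset hF.1 h).antisymm (hF.subset_of_cell_subset hG.1 h')

theorem isFace_empty (hA : IsConfig A) : IsFace A ∅ := by
  have hcone : cone (∅ : Set (Fin d → ℤ)) = {0} := by
    refine Set.eq_singleton_iff_unique_mem.2 ⟨zero_mem_cone, ?_⟩
    rintro x ⟨s, c, hs, -, rfl⟩
    simp [Finset.coe_eq_empty.1 (Set.subset_empty_iff.1 hs)]
  refine ⟨Set.empty_subset _, ⟨cone_mono (Set.empty_subset _), ?_⟩, ?_⟩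
  · rintro x hx y hy z hz ⟨r, t, hr, ht, -, hxy⟩
    rw [hcone, Set.mem_singleton_iff] at hz ⊢
    rw [hz] at hxy
    have h0 := hA.pointed _ (smul_mem_cone hr.le hx)
      (by rw [neg_eq_of_add_eq_zero_right hxy]; exact smul_mem_cone ht.le hy)
    exact (smul_eq_zero.1 h0).resolve_left hr.ne'
  · rw [hcone, Set.image_empty, ← Set.disjoint_iff_inter_eq_empty, Set.disjoint_singleton_left]
    rintro ⟨v, hv, h⟩
    rw [← toR_zero] at h
    exact hA.nonzero (toR_injective h ▸ hv)

/-- The smallest face whose cone contains `w`. -/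
def faceSpan (A : Set (Fin d → ℤ)) (w : Fin d → ℝ) : Set (Fin d → ℤ) :=
  {v ∈ A | ∃ r : ℝ, 0 ≤ r ∧ r • w - toR v ∈ cone A}

theorem mem_cone_faceSpan_iff {w x : Fin d → ℝ} (hx : x ∈ cone A) :
    x ∈ cone (faceSpan A w) ↔ ∃ r : ℝ, 0 ≤ r ∧ r • w - x ∈ cone A := by
  constructor
  · rintro ⟨s, c, hs, hc, rfl⟩
    choose r hr hrw using fun v : s => (hs v.2).2
    refine ⟨∑ v : s, c v * r v, Finset.sum_nonneg fun v _ => mul_nonneg (hc v) (hr v), ?_⟩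
    rw [← Finset.sum_coe_sort s, Finset.sum_smul, ← Finset.sum_sub_distrib]
    refine sum_mem_cone _ _ fun v _ => ?_
    rw [mul_smul, ← smul_sub]
    exact smul_mem_cone (hc v) (hrw v)
  · rintro ⟨r, hr, h⟩
    refine mem_cone_of_summands hx fun v hv t ht htv => ⟨hv, t⁻¹ * r, by positivity, ?_⟩
    have : (t⁻¹ * r) • w - toR v = t⁻¹ • ((r • w - x) + (x - t • toR v)) := by
      rw [sub_add_sub_cancel, smul_sub, smul_smul, smul_smul, inv_mul_cancel₀ ht.ne', one_smul]
    rw [this]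
    exact smul_mem_cone (by positivity) (add_mem_cone h htv)

theorem isFace_faceSpan {w : Fin d → ℝ} : IsFace A (faceSpan A w) := by
  have hsub : faceSpan A w ⊆ A := fun v hv => hv.1
  refine ⟨hsub, ⟨cone_mono hsub, ?_⟩, ?_⟩
  · rintro x hx y hy z hz ⟨p, q, hp, hq, -, rfl⟩
    obtain ⟨r, hr, h⟩ := (mem_cone_faceSpan_iff (cone_mono hsub hz)).1 hz
    refine (mem_cone_faceSpan_iff hx).2 ⟨p⁻¹ * r, by positivity, ?_⟩
    have : (p⁻¹ * r) • w - x = p⁻¹ • ((r • w - (p • x + q • y)) + q • y) := by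
      rw [sub_add_eq_sub_sub, sub_add_cancel, smul_sub, smul_smul, smul_smul,
        inv_mul_cancel₀ hp.ne', one_smul]
    rw [this]
    exact smul_mem_cone (by positivity) (add_mem_cone h (smul_mem_cone hq.le hy))
  · ext x
    constructor
    · rintro ⟨hx, v, hv, rfl⟩
      exact ⟨v, ⟨hv, (mem_cone_faceSpan_iff (toR_mem_cone hv)).1 hx⟩, rfl⟩
    · rintro ⟨v, hv, rfl⟩
      exact ⟨toR_mem_cone hv, v, hv.1, rfl⟩

/-- Elements of the monoid of the smallest face around a lattice point `w` divide
a multiple of `w`. -/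
theorem exists_nsmul_sub_mem {w g : Fin d → ℤ} (hw : w ∈ NSemi A)
    (hg : g ∈ NSemi (faceSpan A (toR w))) : ∃ n : ℕ, n • w - g ∈ NSemi A := by
  have hwc := toR_mem_cone_of_mem_NSemi hw
  have hgA : g ∈ NSemi A := NSemi_mono isFace_faceSpan.1 hg
  obtain ⟨r, -, h⟩ := (mem_cone_faceSpan_iff (toR_mem_cone_of_mem_NSemi hgA)).1
    (toR_mem_cone_of_mem_NSemi hg)
  obtain ⟨M, hM⟩ := exists_nat_ge r
  have hM' : toR (M • w - g) ∈ cone A := by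
    have : toR (M • w - g) = ((M : ℝ) - r) • toR w + (r • toR w - toR g) := by
      rw [toR_sub, toR_nsmul, sub_smul, sub_add_sub_cancel]
    rw [this]
    exact add_mem_cone (smul_mem_cone (sub_nonneg.2 hM) hwc) h
  obtain ⟨n, hn, hmem⟩ := exists_nsmul_mem_NSemi hM'
  obtain ⟨n, rfl⟩ := Nat.exists_eq_succ_of_ne_zero hn.ne'
  refine ⟨(n + 1) * M, ?_⟩
  have : ((n + 1) * M) • w - g = (n + 1) • (M • w - g) + n • g := by
    rw [smul_sub, mul_smul, add_smul n 1 g, one_smul]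
    abel
  rw [this]
  exact add_mem hmem (nsmul_mem hgA n)

theorem eq_zero_of_sum_nsmul_eq_zero (hA : IsConfig A) {s : Finset (Fin d → ℤ)}
    (hs : (s : Set (Fin d → ℤ)) ⊆ A) {n : s → ℕ} (h : ∑ v : s, n v • (v : Fin d → ℤ) = 0) :
    n = 0 := by
  classical
  ext v
  by_contra hv
  have hterm : ∀ u : s, n u • (u : Fin d → ℤ) ∈ NSemi A := fun u =>
    nsmul_mem (AddSubmonoid.subset_closure (hs u.2)) _
  rw [← Finset.add_sum_erase _ _ (Finset.mem_univ v)] at h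
  have h0 : toR (n v • (v : Fin d → ℤ)) = 0 := by
    refine hA.pointed _ (toR_mem_cone_of_mem_NSemi (hterm v)) ?_
    rw [neg_eq_of_add_eq_zero_right (by rw [← toR_add, h, toR_zero])]
    exact toR_mem_cone_of_mem_NSemi (sum_mem fun u _ => hterm u)
  have h1 := toR_injective (h0.trans toR_zero.symm)
  have h2 := (smul_eq_zero.1 h1).resolve_left hv
  exact hA.nonzero (h2 ▸ hs v.2)

theorem exists_factorization_bound (hA : IsConfig A) (x : Fin d → ℤ) :
    ∃ N : ℕ, ∀ m : (Fin d → ℤ) → ℕ, ∑ v ∈ hA.finite.toFinset, m v • v = x →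
      ∑ v ∈ hA.finite.toFinset, m v ≤ N := by
  set s := hA.finite.toFinset with hs
  let T : Set (s → ℕ) := {m | ∑ v : s, m v • (v : Fin d → ℤ) = x}
  have hanti : IsAntichain (· ≤ ·) T := by
    intro m hm n hn hne hle
    have h : n - m = 0 := by
      refine eq_zero_of_sum_nsmul_eq_zero hA (by simp [hs]) ?_
      apply add_left_cancel (a := ∑ v : s, m v • (v : Fin d → ℤ))
      rw [← Finset.sum_add_distrib, add_zero, hm, ← hn]
      refine Finset.sum_congr rfl fun v _ => ?_
      rw [← add_smul, Pi.sub_apply, Nat.add_sub_cancel' (hle v)]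
    exact hne (le_antisymm hle (tsub_eq_zero_iff_le.1 h))
  obtain ⟨N, hN⟩ := ((WellQuasiOrderedLE.finite_of_isAntichain hanti).image
    fun m => ∑ v : s, m v).bddAbove
  refine ⟨N, fun m hm => hN ⟨fun v => m v, ?_, Finset.sum_coe_sort s m⟩⟩
  exact (Finset.sum_coe_sort s fun v => m v • v).trans hm

end Face

section StdPair

variable {d : ℕ} {A E F G : Set (Fin d → ℤ)} {a b : Fin d → ℤ}

theorem StdPair.mem_NSemi (h : StdPair A E a F) : a ∈ NSemi A := h.1.1

theorem StdPair.isFace (h : StdPair A E a F) : IsFace A F := h.1.2.1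

theorem StdPair.add_notMem (h : StdPair A E a F) {f : Fin d → ℤ} (hf : f ∈ NSemi F) :
    a + f ∉ E :=
  (h.1.2.2 (add_mem_cell hf)).2

/-- A standard pair cannot be enlarged to a bigger face. -/
theorem StdPair.exists_add_mem (h : StdPair A E a F) (hG : IsFace A G) (hFG : F ⊆ G)
    (hne : F ≠ G) : ∃ g ∈ NSemi G, a + g ∈ E := by
  by_contra! hE
  have hprop : ProperPair A E a G := by
    refine ⟨h.mem_NSemi, hG, ?_⟩
    rintro _ ⟨g, hg, rfl⟩
    exact ⟨add_mem h.mem_NSemi (NSemi_mono hG.1 hg), hE g hg⟩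
  have hsub := cell_subset_cell hFG (mem_cell_self (a := a) (F := G))
  exact hne (cell_face_eq h.isFace hG hsub (h.2 a G hprop hsub))

theorem StdPair.add_ne_add_of_ssubset (hE : IsExpSet A E) (h : StdPair A E a F)
    (h' : StdPair A E b G) (hFG : F ⊆ G) (hne : F ≠ G) {c g : Fin d → ℤ} (hc : c ∈ NSemi A)
    (hg : g ∈ NSemi G) : a + c ≠ b + g := by
  intro heq
  obtain ⟨f, hf, haf⟩ := h.exists_add_mem h'.isFace hFG hne
  apply h'.add_notMem (add_mem hg hf)
  rw [← add_assoc, ← heq, add_right_comm]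
  exact hE.2 _ haf _ hc

theorem StdPair.eq_of_pairDvd (hE : IsExpSet A E) (h : StdPair A E a F)
    (h' : StdPair A E b G) (hdvd : PairDvd A a F b G) : F = G := by
  obtain ⟨c, hc, hsub⟩ := hdvd
  by_contra hne
  obtain ⟨g, hg, heq⟩ := hsub mem_cell_self
  exact h.add_ne_add_of_ssubset hE h' (h'.isFace.subset_of_cell_subset h.isFace.1 hsub) hne
    hc hg heq

/-- Every element of `A` outside `F` acts nilpotently on a standard pair `(a, F)`,
up to translation by `ℕF`. -/
theorem StdPair.exists_nsmul_mem (hE : IsExpSet A E) (h : StdPair A E a F)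
    {s : Finset (Fin d → ℤ)} (hs : (s : Set (Fin d → ℤ)) = F) {f : Fin d → ℤ} (hfA : f ∈ A)
    (hfF : f ∉ F) : ∃ n : ℕ, a + n • (f + ∑ v ∈ s, v) ∈ E := by
  classical
  have hF := h.isFace.1
  have hsA : ∀ t ⊆ s, ∑ v ∈ t, v ∈ NSemi A := fun t ht =>
    sum_mem fun v hv => AddSubmonoid.subset_closure (hF (hs ▸ Finset.mem_coe.2 (ht hv)))
  have hfA' : f ∈ NSemi A := AddSubmonoid.subset_closure hfA
  set w := f + ∑ v ∈ s, v with hw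
  have hwA : w ∈ NSemi A := add_mem hfA' (hsA s subset_rfl)
  have hface : IsFace A (faceSpan A (toR w)) := isFace_faceSpan
  have hmem : ∀ v ∈ A, w - v ∈ NSemi A → v ∈ faceSpan A (toR w) := fun v hv hwv =>
    ⟨hv, 1, zero_le_one, by
      rw [one_smul, ← toR_sub]; exact toR_mem_cone_of_mem_NSemi hwv⟩
  have hsub : F ⊆ faceSpan A (toR w) := by
    intro v hv
    refine hmem v (hF hv) ?_
    rw [hw, ← Finset.add_sum_erase s _ (Finset.mem_coe.1 (hs ▸ hv)), add_left_comm,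
      add_sub_cancel_left]
    exact add_mem hfA' (hsA _ (Finset.erase_subset _ _))
  have hf : f ∈ faceSpan A (toR w) :=
    hmem f hfA (by rw [hw, add_sub_cancel_left]; exact hsA s subset_rfl)
  obtain ⟨g, hg, hag⟩ := h.exists_add_mem hface hsub fun heq => hfF (heq ▸ hf)
  obtain ⟨n, hn⟩ := exists_nsmul_sub_mem hwA hg
  refine ⟨n, ?_⟩
  have := hE.2 _ hag _ hn
  rwa [add_assoc, add_sub_cancel] at this

/-- Every standard monomial is covered by a standard pair. -/
theorem exists_stdPair_of_mem_stdSet (hA : IsConfig A) (hb : b ∈ stdSet A E) :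
    ∃ a F, StdPair A E a F ∧ b ∈ cell a F := by
  classical
  set s := hA.finite.toFinset with hs
  have hsub : ∀ {F}, IsFace A F → F ⊆ s := fun hF => by simpa [hs] using hF.1
  obtain ⟨N, hN⟩ := exists_factorization_bound hA b
  let cardSet : Set ℕ := {k | ∃ a F, ProperPair A E a F ∧ b ∈ cell a F ∧ F.ncard = k}
  have hcard0 : cardSet.Nonempty := by
    refine ⟨_, b, ∅, ⟨hb.1, isFace_empty hA, ?_⟩, mem_cell_self, rfl⟩
    rintro _ ⟨f, hf, rfl⟩
    rw [NSemi, AddSubmonoid.closure_empty, AddSubmonoid.mem_bot] at hf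
    rwa [hf, add_zero]
  have hcardb : BddAbove cardSet := by
    refine ⟨A.ncard, ?_⟩
    rintro _ ⟨a, F, h, -, rfl⟩
    exact Set.ncard_le_ncard h.2.1.1 hA.finite
  obtain ⟨a₀, F, hF, hbF, hk⟩ := Nat.sSup_mem hcard0 hcardb
  have hmaxF : ∀ {a G}, ProperPair A E a G → b ∈ cell a G → F ⊆ G → F = G := by
    intro a G hG hbG hFG
    refine Set.eq_of_subset_of_ncard_le hFG ?_ (hA.finite.subset hG.2.1.1)
    exact hk ▸ le_csSup hcardb ⟨a, G, hG, hbG, rfl⟩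
  let lenSet : Set ℕ := {k | ∃ (a : Fin d → ℤ) (m : (Fin d → ℤ) → ℕ), ProperPair A E a F ∧
    (∀ v ∉ F, m v = 0) ∧ a + ∑ v ∈ s, m v • v = b ∧ ∑ v ∈ s, m v = k}
  have hlen0 : lenSet.Nonempty := by
    obtain ⟨f, hf, hbf⟩ := hbF
    obtain ⟨m, hm, rfl⟩ := exists_sum_of_mem_NSemi (hsub hF.2.1) hf
    exact ⟨_, a₀, m, hF, hm, hbf.symm, rfl⟩
  have hlenb : BddAbove lenSet := by
    refine ⟨N, ?_⟩
    rintro _ ⟨a, m, h, -, hab, rfl⟩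
    obtain ⟨n, -, rfl⟩ := exists_sum_of_mem_NSemi (s := s) (by simp [hs]) h.1
    refine le_trans ?_ (hN (n + m) ?_)
    · exact Finset.sum_le_sum fun v _ => Nat.le_add_left _ _
    · simpa [add_smul, Finset.sum_add_distrib] using hab
  obtain ⟨a, m, ha, hm, hab, hk'⟩ := Nat.sSup_mem hlen0 hlenb
  have hmF : ∑ v ∈ s, m v • v ∈ NSemi F :=
    sum_mem_NSemi fun v _ => not_imp_comm.1 (hm v)
  have hba : b ∈ cell a F := ⟨_, hmF, hab.symm⟩
  refine ⟨a, F, ⟨ha, fun a' G hG hle => ?_⟩, hba⟩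
  obtain rfl := hmaxF hG (hle hba) (hG.2.1.subset_of_cell_subset ha.2.1.1 hle)
  obtain ⟨f, hf, haf⟩ := hle mem_cell_self
  obtain ⟨n, hn, rfl⟩ := exists_sum_of_mem_NSemi (hsub ha.2.1) hf
  have hle' : ∑ v ∈ s, (n + m) v ≤ ∑ v ∈ s, m v := by
    rw [hk']
    refine le_csSup hlenb ⟨a', n + m, hG, fun v hv => by simp [hm v hv, hn v hv], ?_, rfl⟩
    rw [← hab, haf]
    simp [add_smul, Finset.sum_add_distrib, add_assoc]
  have hn0 : ∀ v ∈ s, n v = 0 := by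
    simpa [Finset.sum_add_distrib] using hle'
  rw [Finset.sum_eq_zero fun v hv => by rw [hn0 v hv, zero_smul], add_zero] at haf
  rw [haf]

/-- Every standard pair divides a standard pair with the same face and maximal overlap class. -/
theorem StdPair.exists_maxClass (hA : IsConfig A) (hE : IsExpSet A E) (h : StdPair A E a F) :
    ∃ b, StdPair A E b F ∧ MaxClass A E b F ∧ ∃ c ∈ NSemi A, a + c ∈ cell b F := by
  classical
  set s := hA.finite.toFinset with hs
  have hsA : A ⊆ s := by simp [hs]
  obtain ⟨sF, hsF⟩ := (hA.finite.subset h.isFace.1).exists_finset_coe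
  have hσ : ∑ v ∈ sF, v ∈ NSemi F :=
    sum_mem fun v hv => AddSubmonoid.subset_closure (hsF ▸ Finset.mem_coe.2 hv)
  have hnil : ∀ f ∈ s \ sF, ∃ n : ℕ, a + n • (f + ∑ v ∈ sF, v) ∈ E := by
    intro f hf
    rw [Finset.mem_sdiff] at hf
    exact h.exists_nsmul_mem hE hsF (by simpa [hs] using hf.1)
      (by rw [← hsF]; exact fun hc => hf.2 (Finset.mem_coe.1 hc))
  choose! n hn using hnil
  let K : Set ℕ := {k | ∃ (b : Fin d → ℤ) (m : (Fin d → ℤ) → ℕ), StdPair A E b F ∧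
    a + ∑ v ∈ s, m v • v ∈ cell b F ∧
    ∑ v ∈ s \ sF, m v = k}
  have hK0 : K.Nonempty := ⟨_, a, 0, h, by simpa using mem_cell_self, rfl⟩
  have hKb : BddAbove K := by
    refine ⟨∑ v ∈ s \ sF, n v, ?_⟩
    rintro _ ⟨b, m, hb, ⟨p, hp, hab⟩, rfl⟩
    refine Finset.sum_le_sum fun f hf => ?_
    by_contra! hlt
    have hfs := (Finset.mem_sdiff.1 hf).1
    have hrest : ∑ v ∈ s, m v • v - n f • f ∈ NSemi A := by
      rw [← Finset.add_sum_erase _ _ hfs, add_sub_right_comm, ← tsub_add_cancel_of_le hlt.le,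
        add_smul, add_sub_cancel_right]
      have hAs : ∀ v ∈ s, v ∈ NSemi A := fun v hv =>
        AddSubmonoid.subset_closure (by simpa [hs] using hv)
      exact add_mem (nsmul_mem (hAs f hfs) _)
        (sum_mem fun v hv => nsmul_mem (hAs v (Finset.mem_of_mem_erase hv)) _)
    apply hb.add_notMem (add_mem hp (nsmul_mem hσ (n f)))
    rw [← add_assoc, ← hab]
    have hmem := hE.2 _ (hn f hf) _ hrest
    convert hmem using 1
    rw [smul_add]
    abel
  obtain ⟨b, m, hb, ⟨p, hp, hab⟩, hk⟩ := Nat.sSup_mem hK0 hKb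
  refine ⟨b, hb, fun b' G hb' hdvd => ?_, _, sum_mem_NSemi (m := m) (s := s) fun v hv _ => by
    simpa [hs] using hv, p, hp, hab⟩
  obtain rfl := hb.eq_of_pairDvd hE hb' hdvd
  obtain ⟨c, hc, hsub⟩ := hdvd
  obtain ⟨q, hq, hbq⟩ := hsub mem_cell_self
  obtain ⟨m', -, rfl⟩ := exists_sum_of_mem_NSemi hsA hc
  have hle : ∑ v ∈ s \ sF, (m + m') v ≤ ∑ v ∈ s \ sF, m v := by
    rw [hk]
    refine le_csSup hKb ⟨b', m + m', hb', ⟨q + p, add_mem hq hp, ?_⟩, rfl⟩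
    rw [← add_assoc, ← hbq, add_right_comm, ← hab]
    simp [add_smul, Finset.sum_add_distrib, add_assoc]
  have h0 : ∀ v ∈ s, v ∉ sF → m' v = 0 := by
    simpa [Finset.sum_add_distrib] using hle
  have hcF : ∑ v ∈ s, m' v • v ∈ NSemi F := sum_mem_NSemi fun v hv hne => by
    rw [← hsF]
    exact not_imp_comm.1 (h0 v hv) hne
  exact ⟨q, NSemi_mono hb.isFace.1 hq, cell_subset_cell subset_rfl ⟨_, hcF, hbq.symm⟩⟩

end StdPair

section MonomialIdeal

variable {d : ℕ} {k : Type*} [Field k] {A F G : Set (Fin d → ℤ)}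

theorem mono_add (a b : NSemi A) : mono k A (a + b) = mono k A a * mono k A b := by
  simp [mono, AddMonoidAlgebra.single_mul_single]

theorem mono_nsmul (n : ℕ) (a : NSemi A) : mono k A (n • a) = mono k A a ^ n := by
  simp [mono, AddMonoidAlgebra.single_pow]

theorem mono_mem_span_iff {S : Set (NSemi A)} {a : NSemi A} :
    mono k A a ∈ Ideal.span ((fun a => mono k A a) '' S) ↔ ∃ b ∈ S, ∃ c, a = c + b := by
  refine (AddMonoidAlgebra.mem_ideal_span_of'_image (s := S)).trans ?_
  simp [mono]

theorem IsMonomialIdeal.mem_iff {I : Ideal (SGRing k A)} (hI : IsMonomialIdeal k A I)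
    {x : SGRing k A} : x ∈ I ↔ ∀ a ∈ x.coeff.support, mono k A a ∈ I := by
  obtain ⟨S, rfl⟩ := hI
  simp only [mono_mem_span_iff]
  exact AddMonoidAlgebra.mem_ideal_span_of'_image (s := S)

theorem mem_expSet_iff {I : Ideal (SGRing k A)} (a : NSemi A) :
    (a : Fin d → ℤ) ∈ expSet k A I ↔ mono k A a ∈ I :=
  ⟨fun ⟨_, h⟩ => h, fun h => ⟨a.2, h⟩⟩

theorem isExpSet_expSet (I : Ideal (SGRing k A)) : IsExpSet A (expSet k A I) := by
  refine ⟨fun x hx => hx.1, ?_⟩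
  rintro e ⟨he, heI⟩ c hc
  refine ⟨add_mem he hc, ?_⟩
  have := I.mul_mem_right (mono k A ⟨c, hc⟩) heI
  rwa [← mono_add] at this

theorem mono_mem_primeF_iff (hF : IsFace A F) {a : NSemi A} :
    mono k A a ∈ primeF k A F ↔ (a : Fin d → ℤ) ∉ NSemi F := by
  have : primeF k A F =
      Ideal.span ((fun a => mono k A a) '' {a : NSemi A | (a : Fin d → ℤ) ∉ NSemi F}) := by
    refine congrArg Ideal.span (Set.ext fun x => ?_)
    exact exists_congr fun a => and_congr_right fun _ => eq_comm
  rw [this, mono_mem_span_iff]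
  constructor
  · rintro ⟨b, hb, c, rfl⟩ h
    exact hb (hF.mem_NSemi_of_add_mem b.2 c.2 (by rwa [add_comm]))
  · exact fun h => ⟨a, h, 0, (zero_add a).symm⟩

theorem IsFace.eq_of_primeF_eq (hF : IsFace A F) (hG : IsFace A G)
    (h : primeF k A F = primeF k A G) :
    F = G := by
  refine hF.eq_of_NSemi_eq hG (le_antisymm ?_ ?_)
  · intro x hx
    by_contra hxG
    exact (mono_mem_primeF_iff hF).1
      (h ▸ (mono_mem_primeF_iff (a := ⟨x, NSemi_mono hF.1 hx⟩) hG).2 hxG) hx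
  · intro x hx
    by_contra hxF
    exact (mono_mem_primeF_iff hG).1
      (h ▸ (mono_mem_primeF_iff (a := ⟨x, NSemi_mono hG.1 hx⟩) hF).2 hxF) hx

/-- If `G ⊄ F` then large multiples of the sum of `G` are exponents of an ideal with
radical `p_F`. -/
theorem exists_nsmul_sum_mem {J : Ideal (SGRing k A)} (hF : IsFace A F)
    (hJ : J.radical = primeF k A F) {s : Finset (Fin d → ℤ)}
    (hs : (s : Set (Fin d → ℤ)) ⊆ A) (hsF : ¬ (s : Set (Fin d → ℤ)) ⊆ F) :
    ∃ n : ℕ, n • ∑ v ∈ s, v ∈ expSet k A J := by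
  classical
  obtain ⟨g, hg, hgF⟩ := Set.not_subset.1 hsF
  have hsA : ∀ v ∈ s, v ∈ NSemi A := fun v hv => AddSubmonoid.subset_closure (hs hv)
  have hgrad : mono k A ⟨g, hsA g hg⟩ ∈ J.radical := by
    rw [hJ, mono_mem_primeF_iff hF]
    exact fun h => hgF (hF.mem_of_mem_NSemi (hs hg) h)
  obtain ⟨n, hn⟩ := hgrad
  rw [← mono_nsmul, ← mem_expSet_iff] at hn
  refine ⟨n, ?_⟩
  rw [← Finset.add_sum_erase _ _ hg, smul_add]
  exact (isExpSet_expSet J).2 _ hn _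
    (nsmul_mem (sum_mem fun v hv => hsA v (Finset.mem_of_mem_erase hv)) n)

end MonomialIdeal

/-- Let `𝒮` be the set of faces to which some standard pair of the
monomial ideal `I` belongs, and for `F ∈ 𝒮` let `C F` be the `p_F`-primary monomial
ideal whose standard monomials are the elements of `ℕA` dividing some element of
`a + ℕF` for a standard pair `(a,F)` of `I` with overlap class maximal with respect to
divisibility.  Then `I = ⋂_{F ∈ 𝒮} C_F`, the primes `p_F` are pairwise distinct, and
the decomposition is irredundant. -/
theorem primary_decomposition_irredundant {d : ℕ} (k : Type*) [Field k]
    (A : Set (Fin d → ℤ)) (hA : IsConfig A)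
    (I : Ideal (SGRing k A)) (hI : IsMonomialIdeal k A I)
    (𝒮 : Set (Set (Fin d → ℤ)))
    (h𝒮 : ∀ F, F ∈ 𝒮 ↔ IsFace A F ∧ ∃ a, StdPair A (expSet k A I) a F)
    (C : Set (Fin d → ℤ) → Ideal (SGRing k A))
    (hC : ∀ F ∈ 𝒮, IsMonomialIdeal k A (C F) ∧
      (C F).IsPrimary ∧ (C F).radical = primeF k A F ∧
      (∀ b, ∀ hb : b ∈ NSemi A, (mono k A ⟨b, hb⟩ ∉ C F ↔
        ∃ a, StdPair A (expSet k A I) a F ∧ MaxClass A (expSet k A I) a F ∧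
          ∃ y ∈ cell a F, y - b ∈ NSemi A))) :
    I = ⨅ F ∈ 𝒮, C F ∧
    (∀ F ∈ 𝒮, ∀ G ∈ 𝒮, F ≠ G → primeF k A F ≠ primeF k A G) ∧
    (∀ G ∈ 𝒮, ¬ (⨅ F ∈ (𝒮 \ {G} : Set (Set (Fin d → ℤ))), C F) ≤ C G) := by
  classical
  have hE := isExpSet_expSet I
  have hstd : ∀ F ∈ 𝒮, ∀ b : NSemi A, mono k A b ∉ C F ↔
      ∃ a, StdPair A (expSet k A I) a F ∧ MaxClass A (expSet k A I) a F ∧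
        ∃ y ∈ cell a F, y - b ∈ NSemi A := fun F hF b => (hC F hF).2.2.2 b b.2
  have hcover : ∀ F, ∀ a, StdPair A (expSet k A I) a F → ∀ b : NSemi A,
      (b : Fin d → ℤ) ∈ cell a F → F ∈ 𝒮 ∧ mono k A b ∉ C F := by
    rintro F a ha b ⟨f, hf, hbf⟩
    have hF : F ∈ 𝒮 := (h𝒮 F).2 ⟨ha.isFace, a, ha⟩
    obtain ⟨a', ha', hmax, c, hc, hac⟩ := ha.exists_maxClass hA hE
    refine ⟨hF, (hstd F hF b).2 ⟨a', ha', hmax, a + c + f,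
      cell_subset_cell subset_rfl hac (add_mem_cell hf), ?_⟩⟩
    rwa [hbf, add_right_comm, add_sub_cancel_left]
  refine ⟨?_, fun F hF G hG hne h => hne (((h𝒮 F).1 hF).1.eq_of_primeF_eq ((h𝒮 G).1 hG).1 h),
    fun G hG hle => ?_⟩
  · have hmono : ∀ b : NSemi A, mono k A b ∈ I ↔ ∀ F ∈ 𝒮, mono k A b ∈ C F := by
      intro b
      constructor
      · intro hb F hF
        by_contra hbF
        obtain ⟨a, ha, -, y, ⟨f, hf, rfl⟩, hy⟩ := (hstd F hF b).1 hbF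
        refine ha.add_notMem hf ?_
        have := hE.2 _ ((mem_expSet_iff b).2 hb) _ hy
        rwa [add_sub_cancel] at this
      · intro h
        by_contra hb
        obtain ⟨a, F, ha, hbF⟩ := exists_stdPair_of_mem_stdSet (E := expSet k A I) hA
          ⟨b.2, fun hb' => hb ((mem_expSet_iff b).1 hb')⟩
        obtain ⟨hF, hbC⟩ := hcover F a ha b hbF
        exact hbC (h F hF)
    ext x
    simp only [Ideal.mem_iInf]
    rw [hI.mem_iff]
    exact ⟨fun h F hF => (hC F hF).1.mem_iff.2 fun a ha => (hmono a).1 (h a ha) F hF,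
      fun h a ha => (hmono a).2 fun F hF => (hC F hF).1.mem_iff.1 (h F hF) a ha⟩
  · obtain ⟨hGface, a, ha⟩ := (h𝒮 G).1 hG
    obtain ⟨s, hs⟩ := (hA.finite.subset hGface.1).exists_finset_coe
    have hsG : ∑ v ∈ s, v ∈ NSemi G :=
      sum_mem fun v hv => AddSubmonoid.subset_closure (hs ▸ Finset.mem_coe.2 hv)
    have hsA := NSemi_mono hGface.1 hsG
    have hfin : 𝒮.Finite := hA.finite.finite_subsets.subset fun F hF => ((h𝒮 F).1 hF).1.1
    have hpow : ∀ F : Set (Fin d → ℤ), ∃ n : ℕ, F ∈ 𝒮 → ¬ G ⊆ F →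
        n • ∑ v ∈ s, v ∈ expSet k A (C F) := by
      intro F
      by_cases hF : F ∈ 𝒮 ∧ ¬ G ⊆ F
      · obtain ⟨n, hn⟩ := exists_nsmul_sum_mem ((h𝒮 F).1 hF.1).1 (hC F hF.1).2.2.1
          (hs ▸ hGface.1) (hs ▸ hF.2)
        exact ⟨n, fun _ _ => hn⟩
      · exact ⟨0, fun h h' => absurd ⟨h, h'⟩ hF⟩
    choose n hn using hpow
    obtain ⟨N, hN⟩ := (hfin.image n).bddAbove
    let b : NSemi A := ⟨a + N • ∑ v ∈ s, v, add_mem ha.mem_NSemi (nsmul_mem hsA N)⟩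
    refine (hcover G a ha b (add_mem_cell (nsmul_mem hsG N))).2 (hle ?_)
    simp only [Ideal.mem_iInf]
    rintro F ⟨hF, hFG⟩
    by_cases hGF : G ⊆ F
    · by_contra hbF
      obtain ⟨a', ha', -, y, ⟨f, hf, rfl⟩, hy⟩ := (hstd F hF b).1 hbF
      refine ha.add_ne_add_of_ssubset hE ha' hGF (fun h => hFG h.symm)
        (add_mem (nsmul_mem hsA N) hy) hf ?_
      rw [← add_assoc]
      exact add_sub_cancel _ _
    · rw [← mem_expSet_iff]
      have hle' : n F ≤ N := hN ⟨F, hF, rfl⟩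
      have := (isExpSet_expSet (C F)).2 _ (hn F hF hGF) _
        (add_mem ha.mem_NSemi (nsmul_mem hsA (N - n F)))
      rwa [add_left_comm, ← add_smul, Nat.add_sub_cancel' hle'] at this

end StdPairsPaper
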